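/- Let α, β, γ, μ, ν be an admissible solution of System B on [0,∞) with β ≡ γ. Then the ratio x(t) := α(t)/β(t) converges, as t → ∞, to a constant x_∞ with 0 < x_∞ < ∞. -/

import Mathlib

/-- **System B**: the homogeneous Ricci flow equations on `SL(2,ℂ)/U(1)` for
real-valued differentiable functions `α β γ μ ν` on a set `s`, with `τ := μ² + ν²`,
together with the admissibility conditions `α > 0`, `β > 0`, `γ > 0`, `βγ > τ`. -/
def IsAdmissibleSolutionB (α β γ μ ν : ℝ → ℝ) (s : Set ℝ) : Prop :=
  ∀ t ∈ s,
    0 < α t ∧ 0 < β t ∧ 0 < γ t ∧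
    μ t ^ 2 + ν t ^ 2 < β t * γ t ∧
    HasDerivWithinAt α
      (2 * (16 * β t * γ t - α t ^ 2) / (β t * γ t - (μ t ^ 2 + ν t ^ 2))) s t ∧
    HasDerivWithinAt β
      (-(β t * (16 * (μ t ^ 2 + ν t ^ 2) - α t ^ 2)) /
        (α t * (β t * γ t - (μ t ^ 2 + ν t ^ 2)))) s t ∧
    HasDerivWithinAt γ
      (-(γ t * (16 * (μ t ^ 2 + ν t ^ 2) - α t ^ 2)) /
        (α t * (β t * γ t - (μ t ^ 2 + ν t ^ 2)))) s t ∧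
    HasDerivWithinAt μ
      (8 - μ t * (16 * β t * γ t - α t ^ 2) /
        (α t * (β t * γ t - (μ t ^ 2 + ν t ^ 2)))) s t ∧
    HasDerivWithinAt ν
      (-(ν t * (16 * β t * γ t - α t ^ 2)) /
        (α t * (β t * γ t - (μ t ^ 2 + ν t ^ 2)))) s t

/-- Barrier lemma: a function whose derivative is positive at the level `m` stays above `m`. -/
lemma barrier_below (f f' : ℝ → ℝ) (T m : ℝ)
    (hf : ∀ t, T ≤ t → HasDerivWithinAt f (f' t) (Set.Ici T) t)
    (h0 : m ≤ f T) (hb : ∀ t, T ≤ t → f t = m → 0 < f' t) :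
    ∀ t, T ≤ t → m ≤ f t := by
  intro t ht
  have key := image_le_of_deriv_right_lt_deriv_boundary (f := fun s => - f s)
    (f' := fun s => - f' s) (a := T) (b := t) (B := fun _ => -m) (B' := fun _ => 0)
    (fun s hs => ((hf s hs.1).neg.continuousWithinAt).mono (fun r hr => hr.1))
    (fun s hs => (hf s hs.1).neg.mono (fun r hr => le_trans hs.1 hr))
    (by simpa using h0) (fun s => hasDerivAt_const s _)
    (fun s hs he => by
      have := hb s hs.1 (by simpa using he)
      linarith)
  have := key (x := t) ⟨ht, le_refl _⟩
  simpa using this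

/-- A function whose derivative dominates `c / (a + K t)` is unbounded above. -/
lemma unbounded_of_deriv (f f' : ℝ → ℝ) (T a K c M : ℝ) (hT : 0 ≤ T) (ha : 0 < a) (hK : 0 < K)
    (hc : 0 < c)
    (hf : ∀ t, T ≤ t → HasDerivWithinAt f (f' t) (Set.Ici T) t)
    (hb : ∀ t, T ≤ t → c / (a + K * t) ≤ f' t) : ∃ t, T ≤ t ∧ M < f t := by
  by_contra! hM
  have hpos : ∀ t, T ≤ t → 0 < a + K * t := fun t ht => by
    have : 0 ≤ t := hT.trans ht
    positivity
  have hlog : ∀ t, T ≤ t →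
      HasDerivAt (fun s => (c / K) * Real.log (a + K * s)) (c / (a + K * t)) t := by
    intro t ht
    have h1 : HasDerivAt (fun s => a + K * s) K t := by
      simpa using ((hasDerivAt_id t).const_mul K).const_add a
    have h2 := (h1.log (hpos t ht).ne').const_mul (c / K)
    refine h2.congr_deriv ?_
    have := (hpos t ht).ne'
    field_simp
  have hmono : MonotoneOn (fun t => f t - (c / K) * Real.log (a + K * t)) (Set.Ici T) := by
    refine monotoneOn_of_hasDerivWithinAt_nonneg (convex_Ici T)
      (f' := fun t => f' t - c / (a + K * t))
      (fun t ht => ((hf t ht).sub (hlog t ht).hasDerivWithinAt).continuousWithinAt) ?_ ?_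
    · intro t ht
      have ht' : t ∈ Set.Ici T := interior_subset ht
      exact ((hf t ht').sub (hlog t ht').hasDerivWithinAt).mono interior_subset
    · intro t ht
      have := hb t (interior_subset ht)
      linarith
  have hlim : Filter.Tendsto (fun t => (c / K) * Real.log (a + K * t)) Filter.atTop
      Filter.atTop := by
    apply Filter.Tendsto.const_mul_atTop (by positivity)
    apply Real.tendsto_log_atTop.comp
    apply Filter.tendsto_atTop_add_const_left
    exact Filter.Tendsto.const_mul_atTop hK Filter.tendsto_id
  obtain ⟨t, ht1, ht2⟩ := ((hlim.eventually_gt_atTop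
    (M - (f T - (c / K) * Real.log (a + K * T)))).and (Filter.eventually_ge_atTop T)).exists
  have h1 := hmono (Set.mem_Ici.2 le_rfl) (Set.mem_Ici.2 ht2) ht2
  have h2 := hM t ht2
  simp only at h1
  linarith

/-- There is no admissible solution of System B on `[0,∞)` with `β ≡ γ`. -/
lemma no_immortal (α β γ μ ν : ℝ → ℝ)
    (h : IsAdmissibleSolutionB α β γ μ ν (Set.Ici 0))
    (hβγ : ∀ t ∈ Set.Ici (0 : ℝ), β t = γ t) : False := by
  obtain ⟨p, hp⟩ : ∃ p : ℝ → ℝ, ∀ t, p t =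
      (16 * β t ^ 2 - α t ^ 2) / (β t ^ 2 - (μ t ^ 2 + ν t ^ 2)) := ⟨_, fun _ => rfl⟩
  have hα : ∀ t, 0 ≤ t → 0 < α t := fun t ht => (h t ht).1
  have hβ : ∀ t, 0 ≤ t → 0 < β t := fun t ht => (h t ht).2.1
  have hD : ∀ t, 0 ≤ t → 0 < β t ^ 2 - (μ t ^ 2 + ν t ^ 2) := fun t ht => by
    have h1 := (h t ht).2.2.2.1
    rw [← hβγ t ht] at h1
    nlinarith
  have hpD : ∀ t, 0 ≤ t → p t * (β t ^ 2 - (μ t ^ 2 + ν t ^ 2)) = 16 * β t ^ 2 - α t ^ 2 :=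
    fun t ht => by rw [hp, div_mul_cancel₀ _ (hD t ht).ne']
  have hμβ : ∀ t, 0 ≤ t → μ t < β t := fun t ht => by
    have := hD t ht
    have := hβ t ht
    by_contra! hc
    nlinarith [sq_nonneg (ν t)]
  have dα : ∀ t, 0 ≤ t → HasDerivWithinAt α (2 * p t) (Set.Ici 0) t := fun t ht => by
    have h1 := (h t ht).2.2.2.2.1
    rw [← hβγ t ht] at h1
    refine h1.congr_deriv (Eq.symm ?_)
    rw [hp, mul_div_assoc]
    ring_nf
  have dβ : ∀ t, 0 ≤ t → HasDerivWithinAt β (β t * (16 - p t) / α t) (Set.Ici 0) t :=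
    fun t ht => by
    have h1 := (h t ht).2.2.2.2.2.1
    rw [← hβγ t ht] at h1
    refine h1.congr_deriv (Eq.symm ?_)
    have hd := hD t ht
    have ha := hα t ht
    rw [show β t * β t = β t ^ 2 by ring, div_eq_div_iff ha.ne' (by positivity)]
    linear_combination (-(β t * α t)) * hpD t ht
  have dμ : ∀ t, 0 ≤ t → HasDerivWithinAt μ (8 - μ t * p t / α t) (Set.Ici 0) t :=
    fun t ht => by
    have h1 := (h t ht).2.2.2.2.2.2.2.1
    rw [← hβγ t ht] at h1
    refine h1.congr_deriv (Eq.symm ?_)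
    congr 1
    have hd := hD t ht
    have ha := hα t ht
    rw [show β t * β t = β t ^ 2 by ring, div_eq_div_iff ha.ne' (by positivity)]
    linear_combination (μ t * α t) * hpD t ht
  have dν : ∀ t, 0 ≤ t → HasDerivWithinAt ν (-(ν t * p t) / α t) (Set.Ici 0) t :=
    fun t ht => by
    have h1 := (h t ht).2.2.2.2.2.2.2.2
    rw [← hβγ t ht] at h1
    refine h1.congr_deriv (Eq.symm ?_)
    have hd := hD t ht
    have ha := hα t ht
    rw [show β t * β t = β t ^ 2 by ring, div_eq_div_iff ha.ne' (by positivity)]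
    linear_combination (-(ν t * α t)) * hpD t ht
  -- the derivative of `α / β`
  have dx : ∀ t, 0 ≤ t →
      HasDerivWithinAt (fun s => α s / β s) ((3 * p t - 16) / β t) (Set.Ici 0) t :=
    fun t ht => by
    have ha := (hα t ht).ne'
    have hb := (hβ t ht).ne'
    refine ((dα t ht).div (dβ t ht) hb).congr_deriv ?_
    field_simp
    ring
  -- the derivative of `μ / β`
  have du : ∀ t, 0 ≤ t →
      HasDerivWithinAt (fun s => μ s / β s) ((8 - 16 * μ t / α t) / β t) (Set.Ici 0) t :=
    fun t ht => by
    have ha := (hα t ht).ne'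
    have hb := (hβ t ht).ne'
    refine ((dμ t ht).div (dβ t ht) hb).congr_deriv ?_
    field_simp
    ring
  -- the derivative of `p`
  have dp : ∀ t, 0 ≤ t → HasDerivWithinAt p
      ((32 * β t ^ 2 * (16 - p t) / α t - 4 * α t * p t
        - p t * ((32 * β t ^ 2 - 2 * p t * (β t ^ 2 - (μ t ^ 2 + ν t ^ 2))) / α t - 16 * μ t))
        / (β t ^ 2 - (μ t ^ 2 + ν t ^ 2))) (Set.Ici 0) t := fun t ht => by
    have ha := (hα t ht).ne'
    have hd := (hD t ht).ne'
    have hN := (((dβ t ht).pow 2).const_mul 16).sub ((dα t ht).pow 2)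
    have hDD := ((dβ t ht).pow 2).sub (((dμ t ht).pow 2).add ((dν t ht).pow 2))
    have hq := hN.div hDD hd
    have hq' := hq.congr (f₁ := p) (fun s _ => hp s) (hp t)
    refine hq'.congr_deriv ?_
    simp only [Pi.sub_apply, Pi.add_apply, Pi.pow_apply]
    rw [← hpD t ht]
    generalize p t = q
    obtain ⟨d, hdd⟩ : ∃ d, d = β t ^ 2 - (μ t ^ 2 + ν t ^ 2) := ⟨_, rfl⟩
    have hν : ν t ^ 2 = β t ^ 2 - μ t ^ 2 - d := by rw [hdd]; ring
    rw [← hdd] at hd ⊢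
    push_cast
    field_simp
    ring_nf
    rw [hν]
    ring
  -- lower bound on `p`
  have hp_low : ∀ t, 0 ≤ t → min (p 0) 0 ≤ p t := by
    refine barrier_below p _ 0 _ dp (min_le_left _ _) ?_
    intro t ht he
    have hle : p t ≤ 0 := he ▸ min_le_right _ _
    have ha := hα t ht
    have hb := hβ t ht
    have hd := hD t ht
    have hm := hμβ t ht
    have hND := hpD t ht
    apply div_pos _ hd
    have hab : 4 * β t ≤ α t := by
      have : p t * (β t ^ 2 - (μ t ^ 2 + ν t ^ 2)) ≤ 0 :=
        mul_nonpos_of_nonpos_of_nonneg hle hd.le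
      by_contra! hc
      nlinarith
    obtain ⟨P, hP⟩ : ∃ P, P = - p t := ⟨_, rfl⟩
    have hpP : p t = -P := by rw [hP, neg_neg]
    have hP0 : 0 ≤ P := by linarith
    rw [hpP]
    have e1 : 0 < 32 * β t ^ 2 * (16 + P) / α t := by positivity
    have e2 : 0 ≤ P * ((32 * β t ^ 2 + 2 * P * (β t ^ 2 - (μ t ^ 2 + ν t ^ 2))) / α t) := by
      positivity
    have e3 : 0 ≤ P * (4 * α t - 16 * μ t) := mul_nonneg hP0 (by linarith)
    have : 32 * β t ^ 2 * (16 - -P) / α t - 4 * α t * -P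
        - -P * ((32 * β t ^ 2 - 2 * -P * (β t ^ 2 - (μ t ^ 2 + ν t ^ 2))) / α t - 16 * μ t)
        = 32 * β t ^ 2 * (16 + P) / α t
          + P * ((32 * β t ^ 2 + 2 * P * (β t ^ 2 - (μ t ^ 2 + ν t ^ 2))) / α t)
          + P * (4 * α t - 16 * μ t) := by ring
    rw [this]
    linarith
  -- when `x ≤ 3`, `x` increases
  have hx_inc : ∀ t, 0 ≤ t → α t / β t ≤ 3 → 5 / β t ≤ (3 * p t - 16) / β t := by
    intro t ht hx
    have ha := hα t ht
    have hb := hβ t ht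
    have hd := hD t ht
    rw [div_le_iff₀ hb] at hx
    have h7 : 7 ≤ p t := by
      rw [hp, le_div_iff₀ hd]
      nlinarith [sq_nonneg (μ t), sq_nonneg (ν t)]
    gcongr
    linarith
  have hx_bar : ∀ T m, 0 ≤ T → m ≤ 3 → m ≤ α T / β T → ∀ t, T ≤ t → m ≤ α t / β t := by
    intro T m hT hm hmT
    refine barrier_below (fun s => α s / β s) _ T m
      (fun t ht => (dx t (hT.trans ht)).mono (Set.Ici_subset_Ici.2 hT)) hmT ?_
    intro t ht he
    have ht0 := hT.trans ht
    have hb := hβ t ht0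
    exact lt_of_lt_of_le (by positivity) (hx_inc t ht0 (he.le.trans hm))
  -- linear growth of `β`
  obtain ⟨m, hm⟩ : ∃ m, m = min (α 0 / β 0) 3 := ⟨_, rfl⟩
  have hm0 : 0 < m := by
    rw [hm]
    exact lt_min (div_pos (hα 0 le_rfl) (hβ 0 le_rfl)) (by norm_num)
  have hxm : ∀ t, 0 ≤ t → m ≤ α t / β t :=
    hx_bar 0 m le_rfl (hm ▸ min_le_right _ _) (hm ▸ min_le_left _ _)
  obtain ⟨K, hK⟩ : ∃ K, K = (17 - min (p 0) 0) / m := ⟨_, rfl⟩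
  have hnum : 0 < 17 - min (p 0) 0 := by
    have := min_le_right (p 0) 0
    linarith
  have hK0 : 0 < K := hK ▸ div_pos hnum hm0
  have hβ' : ∀ t, 0 ≤ t → β t * (16 - p t) / α t < K := by
    intro t ht
    have ha := hα t ht
    have hb := hβ t ht
    have hx := hxm t ht
    have hpl := hp_low t ht
    rw [le_div_iff₀ hb] at hx
    rw [hK, div_lt_div_iff₀ ha hm0]
    calc β t * (16 - p t) * m < β t * (17 - min (p 0) 0) * m := by
          have : 16 - p t < 17 - min (p 0) 0 := by linarith
          gcongr
      _ = (17 - min (p 0) 0) * (m * β t) := by ring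
      _ ≤ _ := by gcongr
  have hβlin : ∀ t, 0 ≤ t → β t ≤ β 0 + K * t := by
    intro t ht
    have hd : ∀ t, 0 ≤ t → HasDerivWithinAt (fun s => (β 0 + K * s) - β s)
        (K - β t * (16 - p t) / α t) (Set.Ici 0) t := by
      intro t ht
      have h1 : HasDerivAt (fun s => β 0 + K * s) K t := by
        simpa using ((hasDerivAt_id t).const_mul K).const_add (β 0)
      exact h1.hasDerivWithinAt.sub (dβ t ht)
    have := barrier_below _ _ 0 0 hd (by simp)
      (fun t ht _ => by have := hβ' t ht; linarith) t ht
    linarith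
  have hdivβ : ∀ c t, 0 < c → 0 ≤ t → c / (β 0 + K * t) ≤ c / β t := by
    intro c t hc ht
    have hb := hβ t ht
    have := hβlin t ht
    gcongr
  -- `x` reaches 3
  obtain ⟨T, hT, hT3⟩ : ∃ T, 0 ≤ T ∧ 3 ≤ α T / β T := by
    by_contra! hc
    obtain ⟨t, ht, ht3⟩ := unbounded_of_deriv (fun s => α s / β s) _ 0 (β 0) K 5 3 le_rfl
      (hβ 0 le_rfl) hK0 (by norm_num) dx
      (fun t ht => (hdivβ 5 t (by norm_num) ht).trans (hx_inc t ht (hc t ht).le))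
    exact absurd (hc t ht) (not_lt.2 ht3.le)
  have hx3 := hx_bar T 3 hT le_rfl hT3
  -- `u = μ / β` is unbounded, a contradiction
  obtain ⟨t, ht, ht1⟩ := unbounded_of_deriv (fun s => μ s / β s) _ T (β 0) K 2 1 hT
      (hβ 0 le_rfl) hK0 (by norm_num)
      (fun t ht => (du t (hT.trans ht)).mono (Set.Ici_subset_Ici.2 hT))
      (fun t ht => by
        have ht0 := hT.trans ht
        refine (hdivβ 2 t (by norm_num) ht0).trans ?_
        have hb := hβ t ht0
        have ha := hα t ht0
        have hmu := hμβ t ht0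
        have hx := hx3 t ht
        rw [le_div_iff₀ hb] at hx
        have : 16 * μ t / α t ≤ 6 := by
          rw [div_le_iff₀ ha]
          linarith
        gcongr
        linarith)
  have hb := hβ t (hT.trans ht)
  rw [lt_div_iff₀ hb] at ht1
  have := hμβ t (hT.trans ht)
  linarith

/-- For an admissible solution of System B on `[0,∞)` with `β ≡ γ`, the ratio
`x(t) := α(t)/β(t)` converges as `t → ∞` to a constant `x_∞ ∈ (0, ∞)`. -/
theorem systemB_ratio_converges (α β γ μ ν : ℝ → ℝ)
    (h : IsAdmissibleSolutionB α β γ μ ν (Set.Ici 0))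
    (hβγ : ∀ t ∈ Set.Ici (0 : ℝ), β t = γ t) :
    ∃ xInf : ℝ, 0 < xInf ∧
      Filter.Tendsto (fun t => α t / β t) Filter.atTop (nhds xInf) := by
  exact (no_immortal α β γ μ ν h hβγ).elim
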